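/- For each fixed m ≥ 2 there is a constant K₂ (one may take K₂ ≥ m²s* + 2^{−m−3/2} m^{4m+5/2} √π D) such that for all n ∈ ℕ, E(L_{m²n}) ≤ m·E(L_{mn}) + K₂·max(√(n ln n), 1). -/

import Mathlib

open MeasureTheory Filter

noncomputable def alignScore {A : Type*} {m n k : ℕ} (S : (Fin m → A) → ℝ)
    (w : Fin m → Fin n → A) (π : Fin m → Fin k → Fin n) : ℝ :=
  ∑ i : Fin k, S (fun j => w j (π j i))

noncomputable def optScore {A : Type*} (m n : ℕ) (S : (Fin m → A) → ℝ)
    (w : Fin m → Fin n → A) : ℝ :=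
  sSup {x : ℝ | ∃ (k : ℕ) (π : Fin m → Fin k → Fin n),
    (∀ j, StrictMono (π j)) ∧ x = alignScore S w π}

def PermInvariant {A : Type*} {m : ℕ} (S : (Fin m → A) → ℝ) : Prop :=
  ∀ (σ : Equiv.Perm (Fin m)) (x : Fin m → A), S (x ∘ σ) = S x

def BddDiffOne {A : Type*} {m : ℕ} (S : (Fin m → A) → ℝ) (D : ℝ) : Prop :=
  ∀ x y : Fin m → A, (∃ j₀, ∀ j, j ≠ j₀ → x j = y j) → |S x - S y| ≤ D

noncomputable def wordMeasure {A : Type*} [MeasurableSpace A] (p : Measure A) (m n : ℕ) :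
    Measure (Fin m → Fin n → A) :=
  Measure.pi fun _ => Measure.pi fun _ => p

noncomputable def expL {A : Type*} [MeasurableSpace A] (p : Measure A) (m n : ℕ)
    (S : (Fin m → A) → ℝ) : ℝ :=
  ∫ w, optScore m n S w ∂(wordMeasure p m n)


section ProbLemmas

theorem aux_push {A : Type*} [Fintype A] [MeasurableSpace A] [MeasurableSingletonClass A]
    (p : Measure A) [IsProbabilityMeasure p] {ι κ : Type*} [Fintype ι] [Fintype κ]
    (Φ : κ → ι) (hΦ : Function.Injective Φ) (g : (κ → A) → ℝ) :
    ∫ w, g (fun k => w (Φ k)) ∂(Measure.pi fun _ : ι => p) =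
      ∫ v, g v ∂(Measure.pi fun _ : κ => p) := by
  have h1 : ProbabilityTheory.iIndepFun (fun (i : ι) (w : ι → A) => w i)
      (Measure.pi fun _ : ι => p) :=
    ProbabilityTheory.iIndepFun_pi (X := fun _ : ι => (id : A → A)) (fun _ => aemeasurable_id)
  have h2 := h1.precomp hΦ
  rw [ProbabilityTheory.iIndepFun_iff_map_fun_eq_pi_map
    (fun i => (measurable_pi_apply _).aemeasurable)] at h2
  have h3 : ∀ k : κ, (Measure.pi fun _ : ι => p).map (fun w : ι → A => w (Φ k)) = p :=
    fun k => (measurePreserving_eval (fun _ : ι => p) (Φ k)).map_eq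
  simp only [h3] at h2
  rw [← h2, integral_map]
  · exact (measurable_pi_lambda _ fun k => measurable_pi_apply _).aemeasurable
  · exact (measurable_of_finite g).aestronglyMeasurable

theorem aux_curry {A : Type*} [Fintype A] [MeasurableSpace A] [MeasurableSingletonClass A]
    (p : Measure A) [IsProbabilityMeasure p] {ι : Type*} [Fintype ι] {κ : ι → Type*}
    [∀ i, Fintype (κ i)]
    (g : (∀ i, κ i → A) → ℝ) :
    ∫ w, g w ∂(Measure.pi fun i : ι => Measure.pi fun _ : κ i => p) =
      ∫ v, g (fun i k => v ⟨i, k⟩) ∂(Measure.pi fun _ : (Σ i, κ i) => p) := by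
  have : (Measure.pi fun _ : (Σ i, κ i) => p).map (fun v i k => v ⟨i, k⟩) =
      (Measure.pi fun i : ι => Measure.pi fun _ : κ i => p) := by
    refine Measure.ext_of_singleton fun w => ?_
    rw [Measure.map_apply (measurable_of_finite _) (measurableSet_singleton _)]
    have : (fun (v : (Σ i, κ i) → A) (i : ι) (k : κ i) => v ⟨i, k⟩) ⁻¹' {w} =
        {fun x => w x.1 x.2} := by
      ext v
      simp only [Set.mem_preimage, Set.mem_singleton_iff]
      constructor
      · rintro rfl; rfl
      · rintro rfl; rfl
    rw [this, Measure.pi_singleton, Measure.pi_singleton, Fintype.prod_sigma]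
    simp [Measure.pi_singleton]
  rw [← this, integral_map]
  · exact (measurable_of_finite _).aemeasurable
  · exact (measurable_of_finite g).aestronglyMeasurable

theorem aux_hoeffding {A : Type*} [Fintype A] [MeasurableSpace A] [MeasurableSingletonClass A]
    (p : Measure A) [IsProbabilityMeasure p] (D : ℝ) (F : A → ℝ)
    (hF : ∀ x y, |F x - F y| ≤ D) (t : ℝ) :
    ∫ x, Real.exp (t * F x) ∂p ≤ Real.exp (t * ∫ x, F x ∂p + t ^ 2 * D ^ 2 / 8) := by
  have hne : Nonempty A := by
    by_contra h
    rw [not_nonempty_iff] at h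
    have := measure_univ (μ := p)
    simp [Set.eq_empty_of_isEmpty] at this
  obtain ⟨x0, hx0⟩ := Finite.exists_min F
  have hD : 0 ≤ D := (abs_nonneg _).trans (hF x0 x0)
  have h := ProbabilityTheory.hasSubgaussianMGF_of_mem_Icc (X := F) (μ := p) (a := F x0)
    (b := F x0 + D) (measurable_of_finite F).aemeasurable
    (Eventually.of_forall fun x => ⟨hx0 x, by linarith [le_abs_self (F x - F x0), hF x x0]⟩)
  have h2 := h.mgf_le t
  rw [ProbabilityTheory.mgf] at h2
  have e : ∀ x, Real.exp (t * F x) =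
      Real.exp (t * ∫ x, F x ∂p) * Real.exp (t * (F x - ∫ x, F x ∂p)) := by
    intro x; rw [← Real.exp_add]; ring_nf
  simp_rw [e]
  rw [integral_const_mul, Real.exp_add]
  refine mul_le_mul_of_nonneg_left (h2.trans (le_of_eq ?_)) (Real.exp_pos _).le
  congr 1
  simp [abs_of_nonneg hD]
  ring

theorem aux_mcd_fin {A : Type*} [Fintype A] [MeasurableSpace A] [MeasurableSingletonClass A]
    (p : Measure A) [IsProbabilityMeasure p] (D : ℝ) (t : ℝ) (N : ℕ) :
    ∀ (F : (Fin N → A) → ℝ)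
    (_ : ∀ x y, (∃ j₀, ∀ j, j ≠ j₀ → x j = y j) → |F x - F y| ≤ D),
    ∫ x, Real.exp (t * F x) ∂(Measure.pi fun _ => p) ≤
      Real.exp (t * ∫ x, F x ∂(Measure.pi fun _ => p) + N * (t ^ 2 * D ^ 2 / 8)) := by
  induction N with
  | zero =>
    intro F hF
    have : ∀ x, F x = F default := fun x => congrArg F (Subsingleton.elim _ _)
    simp_rw [this]
    simp
  | succ N ih =>
    intro F hF
    have key : ∀ G : (Fin (N + 1) → A) → ℝ, ∫ x, G x ∂(Measure.pi fun _ => p) =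
        ∫ y, ∫ x, G (Fin.cons x y) ∂p ∂(Measure.pi fun _ : Fin N => p) := by
      intro G
      have h := ((measurePreserving_piFinSuccAbove (fun _ : Fin (N + 1) => p) 0).symm).integral_comp'
        (g := G)
      have e : ∀ (x : A) (y : Fin N → A),
          (MeasurableEquiv.piFinSuccAbove (fun _ : Fin (N + 1) => A) 0).symm (x, y) =
            Fin.cons x y := by
        intro x y
        change Fin.insertNth (α := fun _ => A) 0 x y = _
        exact Fin.insertNth_zero' (β := A) x y
      rw [← h, integral_prod_symm _ Integrable.of_finite]
      simp only [e]
    have hne : Nonempty A := by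
      by_contra h
      rw [not_nonempty_iff] at h
      have := measure_univ (μ := p)
      simp [Set.eq_empty_of_isEmpty] at this
    have hG := ih (fun y => ∫ x, F (Fin.cons x y) ∂p) (by
      rintro y z ⟨j₀, hj⟩
      rw [← integral_sub Integrable.of_finite Integrable.of_finite]
      have : ∀ x, ‖F (Fin.cons x y) - F (Fin.cons x z)‖ ≤ D := by
        intro x
        refine hF _ _ ⟨j₀.succ, fun j => ?_⟩
        refine Fin.cases (fun _ => rfl) (fun i hi => ?_) j
        simp only [Fin.cons_succ]
        exact hj i (fun h => hi (by rw [h]))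
      simpa using norm_integral_le_of_norm_le_const (μ := p) (Eventually.of_forall this))
    rw [key, key]
    calc ∫ y, ∫ x, Real.exp (t * F (Fin.cons x y)) ∂p ∂(Measure.pi fun _ : Fin N => p)
        ≤ ∫ y, Real.exp (t * ∫ x, F (Fin.cons x y) ∂p) * Real.exp (t ^ 2 * D ^ 2 / 8)
            ∂(Measure.pi fun _ : Fin N => p) := by
          refine integral_mono Integrable.of_finite Integrable.of_finite fun y => ?_
          simp only
          rw [← Real.exp_add]
          refine aux_hoeffding p D (fun x => F (Fin.cons x y)) (fun a b => hF _ _ ⟨0, fun j => ?_⟩) t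
          exact Fin.cases (fun h => absurd rfl h) (fun i _ => by simp) j
      _ ≤ _ := by
          rw [integral_mul_const]
          refine (mul_le_mul_of_nonneg_right hG (Real.exp_pos _).le).trans (le_of_eq ?_)
          rw [← Real.exp_add]
          push_cast
          ring_nf

theorem aux_mcd {A : Type*} [Fintype A] [MeasurableSpace A] [MeasurableSingletonClass A]
    (p : Measure A) [IsProbabilityMeasure p] (D : ℝ) (t : ℝ) {ι : Type*} [Fintype ι]
    (F : (ι → A) → ℝ)
    (hF : ∀ x y, (∃ j₀, ∀ j, j ≠ j₀ → x j = y j) → |F x - F y| ≤ D) :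
    ∫ x, Real.exp (t * F x) ∂(Measure.pi fun _ => p) ≤
      Real.exp (t * ∫ x, F x ∂(Measure.pi fun _ => p) +
        (Fintype.card ι) * (t ^ 2 * D ^ 2 / 8)) := by
  have e := Fintype.equivFin ι
  have h := aux_mcd_fin p D t (Fintype.card ι) (fun v => F (fun i => v (e i))) (by
    rintro x y ⟨j₀, hj⟩
    refine hF _ _ ⟨e.symm j₀, fun j h => hj _ fun h' => h ?_⟩
    rw [← h']; simp)
  rwa [aux_push p e e.injective F,
    aux_push p e e.injective (fun v => Real.exp (t * F v))] at h

theorem aux_pow {A : Type*} [Fintype A] [MeasurableSpace A] [MeasurableSingletonClass A]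
    (p : Measure A) [IsProbabilityMeasure p] {ι κ : Type*} [Fintype ι] [Fintype κ] (m : ℕ)
    (Φ : Fin m → κ → ι) (hΦ : ∀ r k r' k', Φ r k = Φ r' k' → r = r' ∧ k = k')
    (g : (κ → A) → ℝ) :
    ∫ w, ∏ r, g (fun k => w (Φ r k)) ∂(Measure.pi fun _ : ι => p) =
      (∫ v, g v ∂(Measure.pi fun _ : κ => p)) ^ m := by
  have h1 := aux_push p (fun x : (Σ _ : Fin m, κ) => Φ x.1 x.2) (by
    rintro ⟨r, k⟩ ⟨r', k'⟩ h
    obtain ⟨rfl, rfl⟩ := hΦ _ _ _ _ h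
    rfl) (fun v => ∏ r, g (fun k => v ⟨r, k⟩))
  have h2 := aux_curry p (ι := Fin m) (κ := fun _ => κ) (fun w => ∏ r, g (w r))
  have h3 := integral_fintype_prod_eq_pow (ι := Fin m) (𝕜 := ℝ) g
    (μ := Measure.pi fun _ : κ => p)
  simp only [Fintype.card_fin] at h3
  rw [← h3, h2]
  exact h1

end ProbLemmas

section Deterministic

/-- Finite sets of columns which are pairwise strictly comparable. -/
def Chn {m : ℕ} {a : Fin m → ℕ} (P : Finset (∀ j, Fin (a j))) : Prop :=
  ∀ c ∈ P, ∀ d ∈ P, c ≠ d → (∀ j, c j < d j) ∨ (∀ j, d j < c j)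

/-- Score of a set of columns. -/
noncomputable def scr {A : Type*} {m : ℕ} {a : Fin m → ℕ} (S : (Fin m → A) → ℝ)
    (w : (Σ j, Fin (a j)) → A) (P : Finset (∀ j, Fin (a j))) : ℝ :=
  ∑ c ∈ P, S (fun j => w ⟨j, c j⟩)

open Classical in
/-- Optimal score for words of different lengths. -/
noncomputable def LL {A : Type*} {m : ℕ} (S : (Fin m → A) → ℝ) (a : Fin m → ℕ)
    (w : (Σ j, Fin (a j)) → A) : ℝ :=
  (Finset.univ.filter (fun P : Finset (∀ j, Fin (a j)) => Chn P)).sup'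
    ⟨∅, by rw [Finset.mem_filter]; simp [Chn]⟩ (scr S w)

theorem scr_le_LL {A : Type*} {m : ℕ} (S : (Fin m → A) → ℝ) (a : Fin m → ℕ)
    (w : (Σ j, Fin (a j)) → A) (P : Finset (∀ j, Fin (a j))) (hP : Chn P) :
    scr S w P ≤ LL S a w := by
  classical
  exact Finset.le_sup' (scr S w) (by simpa using hP)

theorem LL_nonneg {A : Type*} {m : ℕ} (S : (Fin m → A) → ℝ) (a : Fin m → ℕ)
    (w : (Σ j, Fin (a j)) → A) : 0 ≤ LL S a w := by
  have := scr_le_LL S a w ∅ (by simp [Chn])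
  simpa [scr] using this

theorem ex_LL {A : Type*} {m : ℕ} (S : (Fin m → A) → ℝ) (a : Fin m → ℕ)
    (w : (Σ j, Fin (a j)) → A) : ∃ P, Chn P ∧ LL S a w = scr S w P := by
  classical
  obtain ⟨P, h1, h2⟩ := Finset.exists_mem_eq_sup'
    (s := Finset.univ.filter (fun P : Finset (∀ j, Fin (a j)) => Chn P))
    ⟨∅, by rw [Finset.mem_filter]; simp [Chn]⟩ (scr S w)
  exact ⟨P, by simpa using h1, h2⟩

theorem fam_le_LL {A : Type*} {m : ℕ} (hm : 0 < m) (S : (Fin m → A) → ℝ) (a : Fin m → ℕ)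
    (w : (Σ j, Fin (a j)) → A) {β : Type*} [Fintype β] (f : β → ∀ j, Fin (a j))
    (hf : ∀ b b', b ≠ b' → (∀ j, f b j < f b' j) ∨ (∀ j, f b' j < f b j)) :
    ∑ b, S (fun j => w ⟨j, f b j⟩) ≤ LL S a w := by
  classical
  have hinj : Function.Injective f := by
    intro b b' h
    by_contra hne
    rcases hf b b' hne with h' | h' <;>
    · have := h' ⟨0, hm⟩
      rw [h] at this
      exact lt_irrefl _ this
  have := scr_le_LL S a w (Finset.univ.image f) (by
    intro c hc d hd hcd
    simp only [Finset.mem_image, Finset.mem_univ, true_and] at hc hd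
    obtain ⟨b, rfl⟩ := hc
    obtain ⟨b', rfl⟩ := hd
    exact hf b b' fun h => hcd (by rw [h]))
  rwa [scr, Finset.sum_image (fun x _ y _ h => hinj h)] at this

theorem LL_diff {A : Type*} {m : ℕ} (S : (Fin m → A) → ℝ) (a : Fin m → ℕ) (D : ℝ) (hD : 0 < D)
    (hBD : BddDiffOne S D)
    (w w' : (Σ j, Fin (a j)) → A) (h : ∃ x₀, ∀ x, x ≠ x₀ → w x = w' x) :
    |LL S a w - LL S a w'| ≤ D := by
  have key : ∀ w w' : (Σ j, Fin (a j)) → A, (∃ x₀, ∀ x, x ≠ x₀ → w x = w' x) →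
      LL S a w ≤ LL S a w' + D := by
    rintro w w' ⟨⟨j₀, i₀⟩, h⟩
    obtain ⟨P, hP, e⟩ := ex_LL S a w
    have h1 := scr_le_LL S a w' P hP
    have h2 : scr S w P - scr S w' P ≤ D := by
      rw [scr, scr, ← Finset.sum_sub_distrib]
      have hz : ∀ c : (∀ j, Fin (a j)), c j₀ ≠ i₀ →
          S (fun j => w ⟨j, c j⟩) - S (fun j => w' ⟨j, c j⟩) = 0 := by
        intro c hc
        rw [sub_eq_zero]
        congr 1
        funext j
        refine h _ fun hh => hc ?_
        rw [Sigma.mk.injEq] at hh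
        obtain ⟨rfl, hh⟩ := hh
        exact eq_of_heq hh
      by_cases hc : ∃ c0 ∈ P, c0 j₀ = i₀
      · obtain ⟨c0, hc0, hc0'⟩ := hc
        rw [Finset.sum_eq_single_of_mem c0 hc0]
        · refine (le_abs_self _).trans (hBD _ _ ⟨j₀, fun j hj => h _ fun hh => hj ?_⟩)
          rw [Sigma.mk.injEq] at hh
          exact hh.1
        · intro c hcP hne
          refine hz c fun hh => ?_
          rcases hP c hcP c0 hc0 hne with h' | h' <;>
          · have := h' j₀
            rw [hh, hc0'] at this
            exact lt_irrefl _ this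
      · rw [Finset.sum_eq_zero]
        · exact hD.le
        · intro c hcP
          exact hz c fun hh => hc ⟨c, hcP, hh⟩
    linarith
  rw [abs_le]
  have h1 := key w w' h
  have h2 := key w' w (by obtain ⟨x, hx⟩ := h; exact ⟨x, fun y hy => (hx y hy).symm⟩)
  constructor <;> linarith

theorem optScore_eq_LL {A : Type*} {m : ℕ} (hm : 0 < m) (N : ℕ) (S : (Fin m → A) → ℝ)
    (w : Fin m → Fin N → A) :
    optScore m N S w = LL S (fun _ => N) (fun x => w x.1 x.2) := by
  have hub : ∀ x ∈ {x : ℝ | ∃ (k : ℕ) (π : Fin m → Fin k → Fin N),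
      (∀ j, StrictMono (π j)) ∧ x = alignScore S w π},
      x ≤ LL S (fun _ => N) (fun x => w x.1 x.2) := by
    rintro x ⟨k, π, hπ, rfl⟩
    refine fam_le_LL hm S (fun _ => N) (fun x => w x.1 x.2) (fun (i : Fin k) j => π j i) ?_
    intro b b' hne
    rcases lt_or_gt_of_ne hne with h | h
    · exact Or.inl fun j => hπ j h
    · exact Or.inr fun j => hπ j h
  apply le_antisymm
  · refine csSup_le ⟨0, 0, fun _ i => i.elim0, fun j i => i.elim0, by simp [alignScore]⟩ hub
  · refine le_csSup ⟨_, hub⟩ ?_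
    obtain ⟨P, hP, e⟩ := ex_LL S (fun _ => N) (fun x => w x.1 x.2)
    let j0 : Fin m := ⟨0, hm⟩
    have hinj : ∀ c ∈ P, ∀ d ∈ P, c j0 = d j0 → c = d := by
      intro c hc d hd h
      by_contra hne
      rcases hP c hc d hd hne with h' | h' <;>
      · have := h' j0
        rw [h] at this
        exact lt_irrefl _ this
    have hcard : (P.image (fun c => c j0)).card = P.card :=
      Finset.card_image_of_injOn (fun c hc d hd h => hinj c hc d hd h)
    let E := (P.image (fun c => c j0)).orderEmbOfFin hcard
    have hE : ∀ i, ∃ c ∈ P, c j0 = E i := by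
      intro i
      have := Finset.orderEmbOfFin_mem (P.image (fun c => c j0)) hcard i
      rw [Finset.mem_image] at this
      exact this
    choose c hcP hcE using hE
    refine ⟨P.card, fun j i => c i j, ?_, ?_⟩
    · intro j i i' hi
      have hlt : E i < E i' := E.strictMono hi
      have hne : c i ≠ c i' := by
        intro h
        rw [← hcE, ← hcE, h] at hlt
        exact lt_irrefl _ hlt
      rcases hP _ (hcP i) _ (hcP i') hne with h' | h'
      · exact h' j
      · have := h' j0
        rw [hcE, hcE] at this
        exact absurd hlt (not_lt.2 this.le)
    · rw [e, alignScore, scr]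
      symm
      refine Finset.sum_bij (fun i _ => c i) (fun i _ => hcP i) ?_ ?_ (fun i _ => rfl)
      · intro i _ i' _ h
        apply E.injective
        rw [← hcE, ← hcE, h]
      · intro d hd
        have : d j0 ∈ Set.range E := by
          rw [Finset.range_orderEmbOfFin]
          simpa using ⟨d, hd, rfl⟩
        obtain ⟨i, hi⟩ := this
        exact ⟨i, Finset.mem_univ _, hinj _ (hcP i) _ hd (by rw [hcE, hi])⟩

theorem LL_cut {A : Type*} {m : ℕ} (hm : 0 < m) (S : (Fin m → A) → ℝ)
    (sStar : ℝ) (hs : 0 ≤ sStar) (hSb : ∀ x, S x ≤ sStar) (N M K : ℕ) (hM : 0 < M)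
    (hK : m * N ≤ K * M) (w : (Σ _ : Fin m, Fin N) → A) (B : ℝ) (hB : 0 ≤ B)
    (hbox : ∀ (s a : Fin m → ℕ) (h : ∀ j, s j + a j ≤ N), ∑ j, a j ≤ M →
      LL S a (fun x => w ⟨x.1, ⟨s x.1 + x.2, by have := h x.1; have := x.2.2; omega⟩⟩) ≤ B) :
    LL S (fun _ => N) w ≤ K * (sStar + B) := by
  classical
  obtain ⟨P, hP, e⟩ := ex_LL S (fun _ => N) w
  rw [e, scr]
  have hmaps : ∀ c ∈ P, (∑ j, (c j : ℕ)) / M ∈ Finset.range K := by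
    intro c _
    rw [Finset.mem_range, Nat.div_lt_iff_lt_mul hM]
    refine lt_of_lt_of_le ?_ hK
    have : ∑ j, (c j : ℕ) < ∑ j : Fin m, N :=
      Finset.sum_lt_sum_of_nonempty ⟨⟨0, hm⟩, Finset.mem_univ _⟩ (fun j _ => (c j).2)
    simpa using this
  rw [← Finset.sum_fiberwise_of_maps_to hmaps]
  have : ∀ t ∈ Finset.range K,
      ∑ c ∈ P with (∑ j, (c j : ℕ)) / M = t, S (fun j => w ⟨j, c j⟩) ≤ sStar + B := by
    intro t _
    set Q := P.filter (fun c => (∑ j, (c j : ℕ)) / M = t) with hQ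
    rcases Q.eq_empty_or_nonempty with h0 | hne
    · rw [h0]; simp; positivity
    obtain ⟨d, hd, hdmin⟩ := Finset.exists_min_image Q (fun c => ∑ j, (c j : ℕ)) hne
    obtain ⟨u, hu, humax⟩ := Finset.exists_max_image Q (fun c => ∑ j, (c j : ℕ)) hne
    have hQP : ∀ c ∈ Q, c ∈ P ∧ (∑ j, (c j : ℕ)) / M = t := fun c hc => by simpa [hQ] using hc
    have hlt : ∀ c ∈ Q, ∀ c' ∈ Q, c ≠ c' → (∑ j, (c j : ℕ)) ≤ ∑ j, (c' j : ℕ) →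
        ∀ j, c j < c' j := by
      intro c hc c' hc' hcc hle
      rcases hP c (hQP c hc).1 c' (hQP c' hc').1 hcc with h | h
      · exact h
      · exfalso
        have : ∑ j, (c' j : ℕ) < ∑ j, (c j : ℕ) :=
          Finset.sum_lt_sum_of_nonempty ⟨⟨0, hm⟩, Finset.mem_univ _⟩ (fun j _ => h j)
        omega
    have hdu : ∀ j, (d j : ℕ) ≤ u j := by
      intro j
      by_cases h : d = u
      · rw [h]
      · exact (hlt d hd u hu h (hdmin u hu) j).le
    have hb := hbox (fun j => d j + 1) (fun j => u j - d j) (by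
      intro j; have := hdu j; have := (u j).2; omega) (by
      have h1 : ∑ j, ((u j : ℕ) - d j) + ∑ j, (d j : ℕ) = ∑ j, (u j : ℕ) := by
        rw [← Finset.sum_add_distrib]
        exact Finset.sum_congr rfl fun j _ => Nat.sub_add_cancel (hdu j)
      have h2 := (hQP d hd).2
      have h3 := (hQP u hu).2
      have h4 := Nat.div_add_mod (∑ j, (d j : ℕ)) M
      have h5 := Nat.div_add_mod (∑ j, (u j : ℕ)) M
      have h6 := Nat.mod_lt (∑ j, (u j : ℕ)) hM
      rw [h2] at h4
      rw [h3] at h5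
      omega)
    rw [← Finset.add_sum_erase Q _ hd]
    refine add_le_add (hSb _) (le_trans ?_ hb)
    have hcd : ∀ c : {c // c ∈ Q.erase d}, ∀ j, d j < c.1 j := fun c =>
      hlt d hd c.1 (Finset.mem_of_mem_erase c.2) (Finset.ne_of_mem_erase c.2).symm
        (hdmin _ (Finset.mem_of_mem_erase c.2))
    have hcu : ∀ c : {c // c ∈ Q.erase d}, ∀ j, (c.1 j : ℕ) ≤ u j := by
      intro c j
      by_cases h : c.1 = u
      · rw [h]
      · exact (hlt c.1 (Finset.mem_of_mem_erase c.2) u hu h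
          (humax _ (Finset.mem_of_mem_erase c.2)) j).le
    have hfam := fam_le_LL hm S (fun j => (u j : ℕ) - d j)
      (fun x => w ⟨x.1, ⟨(d x.1 + 1) + x.2, by
        have := hdu x.1; have := (u x.1).2; have := x.2.2; omega⟩⟩)
      (fun (c : {c // c ∈ Q.erase d}) j => (⟨(c.1 j : ℕ) - d j - 1, by
        have h1 := hcd c j; have := hcu c j; rw [Fin.lt_def] at h1; omega⟩ : Fin ((u j : ℕ) - d j)))
      (by
        intro b b' hbb
        have hbP := (hQP _ (Finset.mem_of_mem_erase b.2)).1
        have hbP' := (hQP _ (Finset.mem_of_mem_erase b'.2)).1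
        have h1 := hcd b
        have h2 := hcd b'
        simp only [Fin.lt_def] at h1 h2 ⊢
        rcases hP b.1 hbP b'.1 hbP' (fun h => hbb (Subtype.ext h)) with h | h
        · left; intro j
          have := h j; have := h1 j; have := h2 j
          rw [Fin.lt_def] at *; omega
        · right; intro j
          have := h j; have := h1 j; have := h2 j
          rw [Fin.lt_def] at *; omega)
    refine le_trans (le_of_eq ?_) hfam
    rw [← Finset.sum_coe_sort]
    refine Finset.sum_congr rfl fun c _ => ?_
    congr 1
    funext j
    congr 2
    ext
    have := hcd c j
    rw [Fin.lt_def] at this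
    simp only
    omega
  refine (Finset.sum_le_card_nsmul _ _ _ this).trans ?_
  simp [mul_add]

/-- Offsets of blocks. -/
def off {m : ℕ} [NeZero m] (a : Fin m → ℕ) (j r : Fin m) : ℕ :=
  ∑ r' with r' < r, a (j + r')

theorem off_lt {m : ℕ} [NeZero m] (a : Fin m → ℕ) (j r s : Fin m) (h : r < s) :
    off a j r + a (j + r) ≤ off a j s := by
  classical
  have : r ∉ Finset.univ.filter (fun r' : Fin m => r' < r) := by simp
  rw [off, off, add_comm, ← Finset.sum_insert (f := fun r' => a (j + r')) this]
  refine Finset.sum_le_sum_of_subset ?_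
  intro x hx
  simp only [Finset.mem_insert, Finset.mem_filter, Finset.mem_univ, true_and] at hx ⊢
  rcases hx with rfl | hx
  · exact h
  · exact hx.trans h

theorem off_le {m : ℕ} [NeZero m] (a : Fin m → ℕ) (j r : Fin m) :
    off a j r + a (j + r) ≤ ∑ j, a j := by
  classical
  have : r ∉ Finset.univ.filter (fun r' : Fin m => r' < r) := by simp
  rw [off, add_comm, ← Finset.sum_insert (f := fun r' => a (j + r')) this,
    ← Equiv.sum_comp (Equiv.addLeft j) a]
  exact Finset.sum_le_sum_of_subset (Finset.subset_univ _)

/-- Embedding of the coordinates of a box, rotated by `r`. -/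
def emb {m : ℕ} [NeZero m] (a : Fin m → ℕ) (M : ℕ) (hM : ∑ j, a j ≤ M) (r : Fin m)
    (x : Σ j, Fin (a j)) : Σ _ : Fin m, Fin M :=
  ⟨x.1 - r, ⟨off a (x.1 - r) r + x.2, by
    have h1 := off_le a (x.1 - r) r
    rw [sub_add_cancel] at h1
    have := x.2.2
    omega⟩⟩

theorem emb_inj {m : ℕ} [NeZero m] (a : Fin m → ℕ) (M : ℕ) (hM : ∑ j, a j ≤ M) :
    ∀ r x r' x', emb a M hM r x = emb a M hM r' x' → r = r' ∧ x = x' := by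
  have key : ∀ (r : Fin m) (x : Σ j, Fin (a j)) (r' : Fin m) (x' : Σ j, Fin (a j)),
      emb a M hM r x = emb a M hM r' x' → ¬ r < r' := by
    intro r x r' x' h hlt
    simp only [emb, Sigma.mk.injEq, heq_eq_eq, Fin.mk.injEq] at h
    obtain ⟨h1, h2⟩ := h
    have h3 := off_lt a (x.1 - r) r r' hlt
    rw [← h1, sub_add_cancel] at *
    have := x.2.2
    omega
  intro r x r' x' h
  have hr : r = r' := by
    rcases lt_trichotomy r r' with h' | h' | h'
    · exact absurd h' (key _ _ _ _ h)
    · exact h'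
    · exact absurd h' (key _ _ _ _ h.symm)
  subst hr
  refine ⟨rfl, ?_⟩
  obtain ⟨j, i⟩ := x
  obtain ⟨j', i'⟩ := x'
  simp only [emb, Sigma.mk.injEq, heq_eq_eq, Fin.mk.injEq] at h
  obtain ⟨h1, h2⟩ := h
  have : j = j' := sub_left_injective h1
  subst this
  have : i = i' := by ext; omega
  rw [this]

theorem LL_concat {A : Type*} {m : ℕ} [NeZero m] (S : (Fin m → A) → ℝ) (hperm : PermInvariant S)
    (a : Fin m → ℕ) (M : ℕ) (hM : ∑ j, a j ≤ M) (w : (Σ _ : Fin m, Fin M) → A) :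
    ∑ r, LL S a (fun x => w (emb a M hM r x)) ≤ LL S (fun _ => M) w := by
  classical
  choose P hP e using fun r => ex_LL S a (fun x => w (emb a M hM r x))
  have hf := fam_le_LL (Nat.pos_of_ne_zero (NeZero.ne m)) S (fun _ => M) w
    (β := Σ r : Fin m, {c // c ∈ P r})
    (fun b j => (emb a M hM b.1 ⟨j + b.1, b.2.1 (j + b.1)⟩).2) (by
      have hval : ∀ (b : Σ r : Fin m, {c // c ∈ P r}) (j : Fin m),
          ((emb a M hM b.1 ⟨j + b.1, b.2.1 (j + b.1)⟩).2 : ℕ) =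
            off a j b.1 + (b.2.1 (j + b.1) : ℕ) := by
        intro b j
        simp [emb]
      have key : ∀ b b' : Σ r : Fin m, {c // c ∈ P r}, b.1 < b'.1 →
          ∀ j, (emb a M hM b.1 ⟨j + b.1, b.2.1 (j + b.1)⟩).2 <
            (emb a M hM b'.1 ⟨j + b'.1, b'.2.1 (j + b'.1)⟩).2 := by
        intro b b' h j
        rw [Fin.lt_def, hval, hval]
        have := off_lt a j _ _ h
        have := (b.2.1 (j + b.1)).2
        omega
      intro b b' hne
      rcases lt_trichotomy b.1 b'.1 with h | h | h
      · exact Or.inl (key b b' h)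
      · obtain ⟨r, c, hc⟩ := b
        obtain ⟨r', c', hc'⟩ := b'
        simp only at h
        subst h
        have hcc : c ≠ c' := by
          intro h; subst h; exact hne rfl
        simp only [Fin.lt_def]
        rcases hP r c hc c' hc' hcc with h | h
        · left; intro j; have := h (j + r); rw [Fin.lt_def] at this
          have e1 := hval ⟨r, c, hc⟩ j
          have e2 := hval ⟨r, c', hc'⟩ j
          simp only at e1 e2
          omega
        · right; intro j; have := h (j + r); rw [Fin.lt_def] at this
          have e1 := hval ⟨r, c, hc⟩ j
          have e2 := hval ⟨r, c', hc'⟩ j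
          simp only at e1 e2
          omega
      · exact Or.inr (key b' b h))
  refine le_trans (le_of_eq ?_) hf
  rw [Fintype.sum_sigma]
  refine Finset.sum_congr rfl fun r _ => ?_
  rw [e, scr, ← Finset.sum_coe_sort]
  refine Finset.sum_congr rfl fun c _ => ?_
  rw [← hperm (Equiv.addRight r)]
  congr 1
  funext j
  simp only [Function.comp, Equiv.coe_addRight]
  congr 1
  refine Sigma.ext ?_ (heq_of_eq rfl)
  simp [emb]

end Deterministic

section MainDiscrete

theorem expL_eq {A : Type*} [Fintype A] [MeasurableSpace A] [MeasurableSingletonClass A]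
    (p : Measure A) [IsProbabilityMeasure p] (m : ℕ) (hm : 0 < m) (N : ℕ) (S : (Fin m → A) → ℝ) :
    expL p m N S = ∫ w, LL S (fun _ => N) w ∂(Measure.pi fun _ : (Σ _ : Fin m, Fin N) => p) := by
  rw [expL, wordMeasure, aux_curry p (ι := Fin m) (κ := fun _ => Fin N)]
  simp only [optScore_eq_LL hm]

theorem box_mgf {A : Type*} [Fintype A] [MeasurableSpace A] [MeasurableSingletonClass A]
    (p : Measure A) [IsProbabilityMeasure p] (m : ℕ) [NeZero m] (S : (Fin m → A) → ℝ)
    (hperm : PermInvariant S) (a : Fin m → ℕ) (M : ℕ) (hM : ∑ j, a j ≤ M) (t : ℝ) (ht : 0 ≤ t) :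
    (∫ v, Real.exp (t * LL S a v) ∂(Measure.pi fun _ => p)) ^ m ≤
      ∫ w, Real.exp (t * LL S (fun _ => M) w) ∂(Measure.pi fun _ => p) := by
  rw [← aux_pow p m (emb a M hM) (emb_inj a M hM) (fun v => Real.exp (t * LL S a v))]
  refine integral_mono Integrable.of_finite Integrable.of_finite fun w => ?_
  simp only
  rw [← Real.exp_sum, ← Finset.mul_sum]
  exact Real.exp_le_exp.2 (mul_le_mul_of_nonneg_left (LL_concat S hperm a M hM w) ht)

theorem jensen_exp {Ω : Type*} [Finite Ω] [MeasurableSpace Ω] [MeasurableSingletonClass Ω]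
    (μ : Measure Ω) [IsProbabilityMeasure μ] (f : Ω → ℝ) :
    Real.exp (∫ x, f x ∂μ) ≤ ∫ x, Real.exp (f x) ∂μ := by
  set c := ∫ x, f x ∂μ with hc
  have h : ∫ x, Real.exp c * (f x - c + 1) ∂μ ≤ ∫ x, Real.exp (f x) ∂μ := by
    refine integral_mono Integrable.of_finite Integrable.of_finite fun x => ?_
    have := Real.add_one_le_exp (f x - c)
    have h2 : Real.exp (f x) = Real.exp c * Real.exp (f x - c) := by
      rw [← Real.exp_add]; ring_nf
    simp only
    rw [h2]
    exact mul_le_mul_of_nonneg_left this (Real.exp_pos _).le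
  rw [integral_const_mul, integral_add Integrable.of_finite Integrable.of_finite,
    integral_sub Integrable.of_finite Integrable.of_finite, ← hc] at h
  simpa using h

/-- Boxes of bounded total side length. -/
abbrev Bx (m N M : ℕ) : Type :=
  {x : (Fin m → Fin (N + 1)) × (Fin m → Fin (N + 1)) //
    (∀ j, (x.1 j : ℕ) + (x.2 j : ℕ) ≤ N) ∧ ∑ j, (x.2 j : ℕ) ≤ M}

/-- Coordinates of a box. -/
def shf {m N M : ℕ} (b : Bx m N M) (x : Σ j, Fin (b.1.2 j : ℕ)) : Σ _ : Fin m, Fin N :=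
  ⟨x.1, ⟨(b.1.1 x.1 : ℕ) + x.2, by have := b.2.1 x.1; have := x.2.2; omega⟩⟩

theorem shf_inj {m N M : ℕ} (b : Bx m N M) : Function.Injective (shf b) := by
  rintro ⟨j, i⟩ ⟨j', i'⟩ h
  simp only [shf, Sigma.mk.injEq, heq_eq_eq, Fin.mk.injEq] at h
  obtain ⟨rfl, h⟩ := h
  have : i = i' := by ext; omega
  rw [this]

theorem main_bound {A : Type*} [Fintype A] [MeasurableSpace A] [MeasurableSingletonClass A]
    (p : Measure A) [IsProbabilityMeasure p]
    (m : ℕ) [NeZero m] (S : (Fin m → A) → ℝ)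
    (sStar : ℝ) (hs : 0 ≤ sStar) (hSb : ∀ x, S x ≤ sStar) (hSperm : PermInvariant S)
    (D : ℝ) (hD0 : 0 < D) (hBD : BddDiffOne S D) (n : ℕ) (hn : 1 ≤ n) (t : ℝ) (ht : 0 < t) :
    expL p m (m ^ 2 * n) S ≤ m * expL p m (m * n) S + m ^ 2 * sStar +
      m ^ 2 * (2 * m * Real.log (m ^ 2 * n + 1) / t + m * n * t * D ^ 2 / 8) := by
  classical
  have hm : 0 < m := Nat.pos_of_ne_zero (NeZero.ne m)
  have hmR : (0 : ℝ) < m := by exact_mod_cast hm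
  set N := m ^ 2 * n with hN
  set M := m * n with hMdef
  have hM : 0 < M := Nat.mul_pos hm hn
  rw [expL_eq p m hm, expL_eq p m hm]
  set EM := ∫ w, LL S (fun _ => M) w ∂(Measure.pi fun _ : (Σ _ : Fin m, Fin M) => p) with hEM
  let X : Bx m N M → ((Σ _ : Fin m, Fin N) → A) → ℝ := fun b w =>
    LL S (fun j => (b.1.2 j : ℕ)) (fun x => w (shf b x))
  have hne : Nonempty (Bx m N M) := ⟨⟨(fun _ => 0, fun _ => 0), by simp⟩⟩
  let B : ((Σ _ : Fin m, Fin N) → A) → ℝ := fun w =>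
    (Finset.univ : Finset (Bx m N M)).sup' Finset.univ_nonempty (fun b => X b w)
  have hXB : ∀ b w, X b w ≤ B w := fun b w =>
    Finset.le_sup' (fun b => X b w) (Finset.mem_univ b)
  have hB0 : ∀ w, 0 ≤ B w := fun w => (LL_nonneg _ _ _).trans (hXB hne.some w)
  have h1 : ∀ w, LL S (fun _ => N) w ≤ (m : ℝ) ^ 2 * (sStar + B w) := by
    intro w
    have := LL_cut hm S sStar hs hSb N M (m ^ 2) hM (by rw [hN, hMdef]; apply le_of_eq; ring) w
      (B w) (hB0 w) (by
        intro s a h ha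
        exact hXB ⟨(fun j => ⟨s j, by have := h j; omega⟩, fun j => ⟨a j, by have := h j; omega⟩),
          h, ha⟩ w)
    simpa using this
  set ν := (Measure.pi fun _ : (Σ _ : Fin m, Fin N) => p) with hν
  have h2 : ∫ w, LL S (fun _ => N) w ∂ν ≤ (m : ℝ) ^ 2 * (sStar + ∫ w, B w ∂ν) := by
    refine (integral_mono Integrable.of_finite Integrable.of_finite h1).trans (le_of_eq ?_)
    rw [integral_const_mul, integral_add Integrable.of_finite Integrable.of_finite]
    simp
  have h3 : ∀ b, ∫ w, Real.exp (t * X b w) ∂ν ≤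
      Real.exp (t * EM / m + M * (t ^ 2 * D ^ 2 / 8)) := by
    intro b
    have e1 := aux_push p (shf b) (shf_inj b)
      (fun v => Real.exp (t * LL S (fun j => (b.1.2 j : ℕ)) v))
    have e2 := box_mgf p m S hSperm (fun j => (b.1.2 j : ℕ)) M b.2.2 t ht.le
    have e3 := aux_mcd p D t (LL S (fun _ : Fin m => M)) (LL_diff S _ D hD0 hBD)
    rw [← e1] at e2
    have e4 := e2.trans e3
    refine le_of_pow_le_pow_left₀ (NeZero.ne m) (Real.exp_pos _).le (e4.trans (le_of_eq ?_))
    rw [← Real.exp_nat_mul]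
    congr 1
    simp only [Fintype.card_sigma, Fintype.card_fin, Finset.sum_const, Finset.card_univ,
      smul_eq_mul, Nat.cast_mul]
    rw [← hEM]
    field_simp
  have h4 : ∫ w, Real.exp (t * B w) ∂ν ≤
      (Fintype.card (Bx m N M)) * Real.exp (t * EM / m + M * (t ^ 2 * D ^ 2 / 8)) := by
    calc ∫ w, Real.exp (t * B w) ∂ν ≤ ∫ w, ∑ b, Real.exp (t * X b w) ∂ν := by
          refine integral_mono Integrable.of_finite Integrable.of_finite fun w => ?_
          obtain ⟨b, _, hb⟩ := Finset.exists_mem_eq_sup' (Finset.univ_nonempty (α := Bx m N M))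
            (fun b => X b w)
          have hb' : B w = X b w := hb
          simp only
          rw [hb']
          exact Finset.single_le_sum (f := fun b => Real.exp (t * X b w))
            (fun b _ => (Real.exp_pos _).le) (Finset.mem_univ b)
      _ = ∑ b, ∫ w, Real.exp (t * X b w) ∂ν :=
          integral_finsetSum _ fun b _ => Integrable.of_finite
      _ ≤ _ := by
          refine (Finset.sum_le_card_nsmul _ _ _ fun b _ => h3 b).trans (le_of_eq ?_)
          simp
  have hcard : (Fintype.card (Bx m N M) : ℝ) ≤ ((N : ℝ) + 1) ^ (2 * m) := by
    have := Fintype.card_subtype_le (fun x : (Fin m → Fin (N + 1)) × (Fin m → Fin (N + 1)) =>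
      (∀ j, (x.1 j : ℕ) + (x.2 j : ℕ) ≤ N) ∧ ∑ j, (x.2 j : ℕ) ≤ M)
    have h' : Fintype.card (Bx m N M) ≤ (N + 1) ^ (2 * m) := by
      refine this.trans (le_of_eq ?_)
      simp [two_mul, pow_add]
    exact_mod_cast h'
  have h5 : t * ∫ w, B w ∂ν ≤
      2 * m * Real.log (N + 1) + (t * EM / m + M * (t ^ 2 * D ^ 2 / 8)) := by
    have j := jensen_exp ν (fun w => t * B w)
    rw [integral_const_mul] at j
    have hN1 : (0 : ℝ) < (N : ℝ) + 1 := by positivity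
    have j2 := (j.trans h4).trans (mul_le_mul_of_nonneg_right hcard (Real.exp_pos _).le)
    have : ((N : ℝ) + 1) ^ (2 * m) = Real.exp (2 * m * Real.log (N + 1)) := by
      rw [show (2 * m * Real.log (N + 1) : ℝ) = ((2 * m : ℕ) : ℝ) * Real.log (N + 1) by
        push_cast; ring, Real.exp_nat_mul, Real.exp_log hN1]
    rw [this, ← Real.exp_add] at j2
    exact Real.exp_le_exp.1 j2
  have hNc : (N : ℝ) = m ^ 2 * n := by rw [hN]; push_cast; ring
  have hMc : (M : ℝ) = m * n := by rw [hMdef]; push_cast; ring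
  rw [hNc, hMc] at h5
  have h6 : ∫ w, B w ∂ν ≤ EM / m +
      (2 * m * Real.log (m ^ 2 * n + 1) / t + m * n * t * D ^ 2 / 8) := by
    have : ∫ w, B w ∂ν = (t * ∫ w, B w ∂ν) / t := by field_simp
    rw [this, div_le_iff₀ ht]
    refine h5.trans (le_of_eq ?_)
    field_simp
    ring
  refine h2.trans ?_
  have := mul_le_mul_of_nonneg_left h6 (by positivity : (0 : ℝ) ≤ (m : ℝ) ^ 2)
  have e : (m : ℝ) ^ 2 * (EM / m) = m * EM := by field_simp
  rw [mul_add] at this ⊢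
  rw [e] at this
  linarith

theorem const_bound (m : ℕ) (hm : 2 ≤ m) :
    2 * (m : ℝ) ^ 4 ≤ (2 : ℝ) ^ (-(m : ℝ) - 3 / 2) * (m : ℝ) ^ (4 * (m : ℝ) + 5 / 2) *
          Real.sqrt Real.pi := by
  have hm2 : (2 : ℝ) ≤ m := by exact_mod_cast hm
  have hm0 : (0 : ℝ) < m := by linarith
  have hpi : 1 ≤ Real.sqrt Real.pi := by
    rw [Real.one_le_sqrt]; linarith [Real.pi_gt_three]
  have h1 : (m : ℝ) ^ (-(m : ℝ) - 3 / 2) ≤ (2 : ℝ) ^ (-(m : ℝ) - 3 / 2) :=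
    Real.rpow_le_rpow_of_nonpos (by norm_num) hm2 (by linarith)
  have h2 : (m : ℝ) ^ (5 : ℝ) ≤
      (m : ℝ) ^ (-(m : ℝ) - 3 / 2) * (m : ℝ) ^ (4 * (m : ℝ) + 5 / 2) := by
    rw [← Real.rpow_add hm0]
    exact Real.rpow_le_rpow_of_exponent_le (by linarith) (by linarith)
  have h3 : (m : ℝ) ^ (5 : ℝ) = (m : ℝ) ^ 5 := by
    exact_mod_cast Real.rpow_natCast (m : ℝ) 5
  have h4 : 2 * (m : ℝ) ^ 4 ≤ (m : ℝ) ^ 5 := by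
    rw [pow_succ _ 4, mul_comm]
    exact mul_le_mul_of_nonneg_left hm2 (by positivity)
  have h5 : (m : ℝ) ^ (-(m : ℝ) - 3 / 2) * (m : ℝ) ^ (4 * (m : ℝ) + 5 / 2) ≤
      (2 : ℝ) ^ (-(m : ℝ) - 3 / 2) * (m : ℝ) ^ (4 * (m : ℝ) + 5 / 2) :=
    mul_le_mul_of_nonneg_right h1 (by positivity)
  have h6 : 0 ≤ (2 : ℝ) ^ (-(m : ℝ) - 3 / 2) * (m : ℝ) ^ (4 * (m : ℝ) + 5 / 2) := by positivity
  rw [h3] at h2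
  calc 2 * (m : ℝ) ^ 4 ≤ (2 : ℝ) ^ (-(m : ℝ) - 3 / 2) * (m : ℝ) ^ (4 * (m : ℝ) + 5 / 2) := by
        linarith
    _ ≤ _ := le_mul_of_one_le_right h6 hpi

theorem log_bound (m : ℕ) (hm : 2 ≤ m) (n : ℕ) (hn : 1 ≤ n) :
    n * Real.log (m ^ 2 * n + 1) ≤
      4 * (m : ℝ) ^ 2 * (max (Real.sqrt (n * Real.log n)) 1) ^ 2 := by
  have hm2 : (2 : ℝ) ≤ m := by exact_mod_cast hm
  have hn1 : (1 : ℝ) ≤ n := by exact_mod_cast hn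
  set T := max (Real.sqrt (n * Real.log n)) 1 with hT
  have hT1 : 1 ≤ T := le_max_right _ _
  have hlog : 0 ≤ Real.log n := Real.log_nonneg hn1
  have hT2 : n * Real.log n ≤ T ^ 2 := by
    have : Real.sqrt (n * Real.log n) ≤ T := le_max_left _ _
    calc n * Real.log n = (Real.sqrt (n * Real.log n)) ^ 2 := by
          rw [Real.sq_sqrt (by positivity)]
      _ ≤ T ^ 2 := by gcongr
  have hmm : Real.log ((m : ℝ) ^ 2 + 1) ≤ (m : ℝ) ^ 2 := by
    have := Real.log_le_sub_one_of_pos (by positivity : (0 : ℝ) < (m : ℝ) ^ 2 + 1)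
    linarith
  have hT3 : 1 ≤ T ^ 2 := one_le_pow₀ hT1
  rcases hn.eq_or_lt with h | h
  · subst h
    simp only [Nat.cast_one, mul_one, one_mul]
    nlinarith
  · have hn2 : (2 : ℝ) ≤ n := by exact_mod_cast h
    have hl2 : 1 / 2 ≤ Real.log n := by
      have := Real.log_le_log (by norm_num) hn2
      linarith [Real.log_two_gt_d9]
    have h1 : Real.log (m ^ 2 * n + 1) ≤ Real.log n + Real.log ((m : ℝ) ^ 2 + 1) := by
      rw [← Real.log_mul (by positivity) (by positivity)]
      apply Real.log_le_log (by positivity)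
      nlinarith
    have h2 : Real.log (m ^ 2 * n + 1) ≤ 4 * (m : ℝ) ^ 2 * Real.log n := by
      have : (m : ℝ) ^ 2 ≤ 2 * m ^ 2 * Real.log n := by nlinarith [sq_nonneg (m : ℝ)]
      have : Real.log n ≤ 2 * m ^ 2 * Real.log n :=
        le_mul_of_one_le_left hlog (by nlinarith)
      linarith
    calc (n : ℝ) * Real.log (m ^ 2 * n + 1) ≤ n * (4 * (m : ℝ) ^ 2 * Real.log n) := by gcongr
      _ = 4 * (m : ℝ) ^ 2 * (n * Real.log n) := by ring
      _ ≤ _ := by gcongr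

theorem stmt5_discrete {A : Type*} [Fintype A] [Nonempty A] [MeasurableSpace A]
    [MeasurableSingletonClass A]
    (p : Measure A) [IsProbabilityMeasure p]
    (m : ℕ) (hm : 2 ≤ m) (S : (Fin m → A) → ℝ) (hS0 : ∀ x, 0 ≤ S x)
    (sStar : ℝ) (hSb : ∀ x, S x ≤ sStar) (hSperm : PermInvariant S)
    (D : ℝ) (hD0 : 0 < D) (hBD : BddDiffOne S D) :
    ∀ K₂ : ℝ,
      (m : ℝ) ^ 2 * sStar +
        (2 : ℝ) ^ (-(m : ℝ) - 3 / 2) * (m : ℝ) ^ (4 * (m : ℝ) + 5 / 2) *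
          Real.sqrt Real.pi * D ≤ K₂ →
      ∀ n : ℕ, 1 ≤ n →
        expL p m (m ^ 2 * n) S ≤
          m * expL p m (m * n) S + K₂ * max (Real.sqrt (n * Real.log n)) 1 := by
  intro K₂ hK n hn
  have : NeZero m := ⟨by omega⟩
  have hs : 0 ≤ sStar := (hS0 (Classical.arbitrary _)).trans (hSb _)
  have hm2 : (2 : ℝ) ≤ m := by exact_mod_cast hm
  have hn1 : (1 : ℝ) ≤ n := by exact_mod_cast hn
  have hlb := log_bound m hm n hn
  set T := max (Real.sqrt (n * Real.log n)) 1 with hT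
  have hT1 : 1 ≤ T := le_max_right _ _
  have hb := main_bound p m S sStar hs hSb hSperm D hD0 hBD n hn (8 * m * T / (n * D))
    (by positivity)
  have e1 : 2 * m * Real.log (m ^ 2 * n + 1) / (8 * m * T / (n * D)) ≤ m ^ 2 * D * T := by
    rw [div_le_iff₀ (by positivity)]
    have : m ^ 2 * D * T * (8 * m * T / (n * D)) = 2 * m * (4 * m ^ 2 * T ^ 2) / n := by
      field_simp; ring
    rw [this, le_div_iff₀ (by positivity)]
    nlinarith
  have e2 : m * n * (8 * m * T / (n * D)) * D ^ 2 / 8 = m ^ 2 * D * T := by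
    field_simp
  rw [e2] at hb
  have e3 := mul_le_mul_of_nonneg_left e1 (by positivity : (0 : ℝ) ≤ (m : ℝ) ^ 2)
  have e4 : (m : ℝ) ^ 2 * sStar ≤ m ^ 2 * sStar * T :=
    le_mul_of_one_le_right (by positivity) hT1
  have e5 := mul_le_mul_of_nonneg_right (const_bound m hm) hD0.le
  have e6 : ((m : ℝ) ^ 2 * sStar + 2 * m ^ 4 * D) * T ≤ K₂ * T :=
    mul_le_mul_of_nonneg_right (by linarith) (by linarith)
  rw [mul_add] at hb
  nlinarith

end MainDiscrete

section Reduction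

theorem atom_symm {A : Type*} [MeasurableSpace A] {a b : A} (h : b ∈ measurableAtom a) :
    a ∈ measurableAtom b := by
  rw [measurableAtom, Set.mem_iInter₂] at *
  intro s hs
  rw [Set.mem_iInter]
  intro hsm
  by_contra ha
  have := h sᶜ ha
  rw [Set.mem_iInter] at this
  exact this hsm.compl hs

theorem atom_eq {A : Type*} [MeasurableSpace A] {a b : A} (h : b ∈ measurableAtom a) :
    measurableAtom b = measurableAtom a :=
  Set.Subset.antisymm (measurableAtom_subset_of_mem h) (measurableAtom_subset_of_mem (atom_symm h))

theorem measurable_of_atom {A B : Type*} [Fintype A] [MeasurableSpace A] [MeasurableSpace B]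
    (f : A → B) (hf : ∀ a, ∀ b ∈ measurableAtom a, f b = f a) : Measurable f := by
  intro s _
  have : f ⁻¹' s = ⋃ a ∈ f ⁻¹' s, measurableAtom a := by
    ext b
    simp only [Set.mem_iUnion, exists_prop]
    constructor
    · intro h
      exact ⟨b, h, mem_measurableAtom_self b⟩
    · rintro ⟨a, ha, hb⟩
      rw [Set.mem_preimage, hf a b hb]
      exact ha
  rw [this]
  exact MeasurableSet.biUnion (Set.to_countable _)
    fun a _ => MeasurableSet.measurableAtom_of_countable a

theorem word_closed {A : Type*} [MeasurableSpace A] {m N : ℕ} (T : Set (Fin m → Fin N → A))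
    (hT : MeasurableSet T) (w w' : Fin m → Fin N → A)
    (h : ∀ j i, w' j i ∈ measurableAtom (w j i)) (hw : w ∈ T) : w' ∈ T := by
  let f : Bool → Fin m → Fin N → A := fun b => if b then w else w'
  have hf : @Measurable Bool _ ⊥ _ f := by
    refine @measurable_pi_lambda Bool (Fin m) _ ⊥ _ f fun j => ?_
    refine @measurable_pi_lambda Bool (Fin N) _ ⊥ _ (fun b => f b j) fun i => ?_
    intro s hs
    rw [MeasurableSpace.measurableSet_bot_iff]
    by_cases hws : w j i ∈ s
    · right
      have := mem_of_mem_measurableAtom (h j i) hs hws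
      ext b
      cases b <;> simp [f, hws, this]
    · left
      have : w' j i ∉ s := fun h' => hws (mem_of_mem_measurableAtom (atom_symm (h j i)) hs h')
      ext b
      cases b <;> simp [f, hws, this]
  have h2 := hf hT
  rw [MeasurableSpace.measurableSet_bot_iff] at h2
  have h3 : true ∈ f ⁻¹' T := by simpa [f] using hw
  rcases h2 with h2 | h2
  · rw [h2] at h3; exact absurd h3 (Set.notMem_empty _)
  · have : false ∈ f ⁻¹' T := by rw [h2]; trivial
    simpa [f] using this

theorem aesm_const {A : Type*} [Fintype A] [MeasurableSpace A] (p : Measure A)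
    [IsProbabilityMeasure p] {m N : ℕ} (f : (Fin m → Fin N → A) → ℝ)
    (hf : AEStronglyMeasurable f (wordMeasure p m N)) (w w' : Fin m → Fin N → A)
    (hw : ∀ j i, p (measurableAtom (w j i)) ≠ 0)
    (h : ∀ j i, w' j i ∈ measurableAtom (w j i)) : f w = f w' := by
  obtain ⟨g, hg, hfg⟩ := hf
  have hgm := hg.measurable
  have hnull : wordMeasure p m N {v | ¬ f v = g v} = 0 := ae_iff.1 hfg
  set T := toMeasurable (wordMeasure p m N) {v | ¬ f v = g v} with hT
  have hTm : MeasurableSet T := measurableSet_toMeasurable _ _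
  have hT0 : wordMeasure p m N T = 0 := by rw [hT, measure_toMeasurable, hnull]
  have hwT : w ∉ T := by
    intro hwT
    have hsub : (Set.univ.pi fun j => Set.univ.pi fun i => measurableAtom (w j i)) ⊆ T := by
      intro v hv
      refine word_closed T hTm w v (fun j i => ?_) hwT
      exact hv j trivial i trivial
    have h0 := measure_mono_null hsub hT0
    rw [wordMeasure, Measure.pi_pi] at h0
    simp only [Measure.pi_pi, Finset.prod_eq_zero_iff] at h0
    obtain ⟨j, _, i, _, h0⟩ := h0
    exact hw j i h0
  have hwT' : w' ∉ T := fun h' => hwT (word_closed T hTm w' w (fun j i => atom_symm (h j i)) h')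
  have hsub : {v | ¬ f v = g v} ⊆ T := subset_toMeasurable _ _
  have e1 : f w = g w := by by_contra hh; exact hwT (hsub hh)
  have e2 : f w' = g w' := by by_contra hh; exact hwT' (hsub hh)
  have e3 : g w' = g w :=
    word_closed (g ⁻¹' {g w}) (hgm (measurableSet_singleton _)) w w' h rfl
  rw [e1, e2, e3]

theorem optScore_const {A : Type*} {m : ℕ} (hm : 0 < m) (N : ℕ) (S : (Fin m → A) → ℝ)
    (hS0 : ∀ x, 0 ≤ S x) (x : Fin m → A) :
    optScore m N S (fun j _ => x j) = N * S x := by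
  have hub : ∀ y ∈ {y : ℝ | ∃ (k : ℕ) (π : Fin m → Fin k → Fin N),
      (∀ j, StrictMono (π j)) ∧ y = alignScore S (fun j _ => x j) π}, y ≤ N * S x := by
    rintro y ⟨k, π, hπ, rfl⟩
    have hk : k ≤ N := by
      simpa using Fintype.card_le_of_injective _ (hπ ⟨0, hm⟩).injective
    have : (k : ℝ) ≤ N := by exact_mod_cast hk
    simp only [alignScore, Finset.sum_const, Finset.card_univ, Fintype.card_fin, nsmul_eq_mul]
    exact mul_le_mul_of_nonneg_right this (hS0 x)
  apply le_antisymm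
  · exact csSup_le ⟨0, 0, fun _ i => i.elim0, fun j i => i.elim0, by simp [alignScore]⟩ hub
  · refine le_csSup ⟨_, hub⟩ ⟨N, fun _ i => i, fun _ => strictMono_id, ?_⟩
    simp [alignScore]

theorem expL_transfer {A B : Type*} [Fintype A] [MeasurableSpace A] [Fintype B]
    [MeasurableSpace B] [MeasurableSingletonClass B]
    (p : Measure A) [IsProbabilityMeasure p] (m N : ℕ) (S : (Fin m → A) → ℝ)
    (S' : (Fin m → B) → ℝ) (r : A → B) (hr : Measurable r)
    (hS : ∀ x, (∀ j, p (measurableAtom (x j)) ≠ 0) → S x = S' (fun j => r (x j))) :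
    expL p m N S = expL (p.map r) m N S' := by
  have : IsProbabilityMeasure (p.map r) := Measure.isProbabilityMeasure_map hr.aemeasurable
  have hmap : wordMeasure (p.map r) m N = (wordMeasure p m N).map (fun w j i => r (w j i)) := by
    have h1 : (Measure.pi fun _ : Fin N => p).map (fun v i => r (v i)) =
        Measure.pi fun _ : Fin N => p.map r := Measure.pi_map_pi fun _ => hr.aemeasurable
    have hr' : Measurable (fun (v : Fin N → A) i => r (v i)) :=
      measurable_pi_lambda _ fun i => hr.comp (measurable_pi_apply i)
    have : IsProbabilityMeasure ((Measure.pi fun _ : Fin N => p).map (fun v i => r (v i))) :=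
      Measure.isProbabilityMeasure_map hr'.aemeasurable
    rw [wordMeasure, wordMeasure, ← h1]
    exact (Measure.pi_map_pi (μ := fun _ : Fin m => Measure.pi fun _ : Fin N => p)
      (f := fun _ v i => r (v i)) fun _ => hr'.aemeasurable).symm
  have hgood : ∀ᵐ a ∂p, p (measurableAtom a) ≠ 0 := by
    rw [ae_iff]
    have hsub : {a | ¬ p (measurableAtom a) ≠ 0} ⊆
        ⋃ a ∈ {a | ¬ p (measurableAtom a) ≠ 0}, measurableAtom a := by
      intro a ha
      exact Set.mem_biUnion ha (mem_measurableAtom_self a)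
    refine measure_mono_null hsub ?_
    rw [measure_biUnion_null_iff (Set.to_countable _)]
    intro a ha
    exact not_not.1 ha
  have hgoodw : ∀ᵐ w ∂(wordMeasure p m N), ∀ j i, p (measurableAtom (w j i)) ≠ 0 := by
    rw [ae_all_iff]
    intro j
    rw [ae_all_iff]
    intro i
    have q1 := (measurePreserving_eval (fun _ : Fin N => p) i).quasiMeasurePreserving.ae hgood
    exact (measurePreserving_eval
      (fun _ : Fin m => Measure.pi fun _ : Fin N => p) j).quasiMeasurePreserving.ae q1
  rw [expL, expL, hmap, integral_map]
  · refine integral_congr_ae ?_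
    filter_upwards [hgoodw] with w hw
    have : ∀ (k : ℕ) (π : Fin m → Fin k → Fin N),
        alignScore S w π = alignScore S' (fun j i => r (w j i)) π := by
      intro k π
      exact Finset.sum_congr rfl fun i _ => hS _ fun j => hw _ _
    simp only [optScore, this]
  · exact (measurable_pi_lambda _ fun j => measurable_pi_lambda _ fun i =>
      hr.comp ((measurable_pi_apply i).comp (measurable_pi_apply j))).aemeasurable
  · exact (measurable_of_finite _).aestronglyMeasurable

end Reduction


theorem stmt5 {A : Type*} [Fintype A] [Nonempty A] [MeasurableSpace A]
    (p : Measure A) [IsProbabilityMeasure p]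
    (m : ℕ) (hm : 2 ≤ m) (S : (Fin m → A) → ℝ) (hS0 : ∀ x, 0 ≤ S x)
    (sStar : ℝ) (hSb : ∀ x, S x ≤ sStar) (hSperm : PermInvariant S)
    (D : ℝ) (hD0 : 0 < D) (hBD : BddDiffOne S D) :
    ∀ K₂ : ℝ,
      (m : ℝ) ^ 2 * sStar +
        (2 : ℝ) ^ (-(m : ℝ) - 3 / 2) * (m : ℝ) ^ (4 * (m : ℝ) + 5 / 2) *
          Real.sqrt Real.pi * D ≤ K₂ →
      ∀ n : ℕ, 1 ≤ n →
        expL p m (m ^ 2 * n) S ≤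
          m * expL p m (m * n) S + K₂ * max (Real.sqrt (n * Real.log n)) 1 := by
  intro K₂ hK n hn
  have hm0 : 0 < m := by omega
  have hs : 0 ≤ sStar := (hS0 (Classical.arbitrary _)).trans (hSb _)
  have hK0 : 0 ≤ K₂ := le_trans (by positivity) hK
  by_cases hI : Integrable (fun w => optScore m (m ^ 2 * n) S w) (wordMeasure p m (m ^ 2 * n))
  swap
  · have h0 : expL p m (m ^ 2 * n) S = 0 := integral_undef hI
    have h1 : 0 ≤ expL p m (m * n) S := by
      refine integral_nonneg fun w => ?_
      simp only [Pi.zero_apply]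
      rw [optScore_eq_LL hm0]
      exact LL_nonneg _ _ _
    rw [h0]
    positivity
  have hatom : ∀ x : Fin m → A, (∀ j, p (measurableAtom (x j)) ≠ 0) →
      ∀ x' : Fin m → A, (∀ j, x' j ∈ measurableAtom (x j)) → S x = S x' := by
    intro x hx x' hx'
    have h := aesm_const p _ hI.aestronglyMeasurable (fun j _ => x j) (fun j _ => x' j)
      (fun j _ => hx j) (fun j _ => hx' j)
    rw [optScore_const hm0 _ S hS0, optScore_const hm0 _ S hS0] at h
    have hne : ((m ^ 2 * n : ℕ) : ℝ) ≠ 0 := by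
      have : 0 < m ^ 2 * n := by positivity
      exact_mod_cast this.ne'
    exact mul_left_cancel₀ hne h
  classical
  let pick : Set A → A := fun s => if h : s.Nonempty then h.some else Classical.arbitrary A
  let rep : A → A := fun a => pick (measurableAtom a)
  have hrep : ∀ a, rep a ∈ measurableAtom a := by
    intro a
    have h : (measurableAtom a).Nonempty := ⟨a, mem_measurableAtom_self a⟩
    simp only [rep, pick, dif_pos h]
    exact h.some_mem
  let e := Fintype.equivFin A
  let r : A → Fin (Fintype.card A) := fun a => e (rep a)
  have hr : Measurable r := by
    refine measurable_of_atom r fun a b hb => ?_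
    simp only [r, rep]
    rw [atom_eq hb]
  let S' : (Fin m → Fin (Fintype.card A)) → ℝ := fun y => S (fun j => e.symm (y j))
  have hSS' : ∀ x, (∀ j, p (measurableAtom (x j)) ≠ 0) → S x = S' (fun j => r (x j)) := by
    intro x hx
    simp only [S', r, Equiv.symm_apply_apply]
    exact hatom x hx _ fun j => hrep _
  rw [expL_transfer p m (m ^ 2 * n) S S' r hr hSS', expL_transfer p m (m * n) S S' r hr hSS']
  have : IsProbabilityMeasure (p.map r) := Measure.isProbabilityMeasure_map hr.aemeasurable
  have : Nonempty (Fin (Fintype.card A)) := ⟨e (Classical.arbitrary A)⟩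
  refine stmt5_discrete (p.map r) m hm S' (fun x => hS0 _) sStar (fun x => hSb _) ?_ D hD0 ?_
    K₂ hK n hn
  · intro σ x
    exact hSperm σ (fun j => e.symm (x j))
  · rintro x y ⟨j₀, hj⟩
    exact hBD _ _ ⟨j₀, fun j hne => by rw [hj j hne]⟩
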